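/- (Theorem 3.3, dual Murnaghan–Nakayama rule) Let λ and μ be partitions of n, and fix N ≥ n. Define χ^λ_μ(q) = (q^n/(q−1)^{ℓ(μ)}) · ⟨q_μ(x;q^{−1}), s_λ⟩, an element of ℚ(q) (this is the value of the irreducible character χ^λ of the Iwahori–Hecke algebra H_n(q) of type A on the standard element T_{γ_μ}). Then χ^λ_μ(q) = ∑_{τ ∈ C_μ} q^{λ_1 − ℓ(τ)} · ∑_{b ∈ B_{|τ|−λ_1}} (q−1)^{ℓ(τ) − ℓ(μ) + ℓ(μ−τ) + ℓ(b)} · (∏_{j=1}^{ℓ(b)} 1/(q^{−r_j(b)} − 1)) · χ^{λ^{[1]}}_{(μ−τ)∪b}(q), where the outer sum runs over all sequences τ = (τ_1,…,τ_{ℓ(μ)}) of nonnegative integers with τ_i ≤ μ_i, λ^{[1]} = (λ_2, λ_3, …) is λ with its first part removed, ℓ(τ) is the number of nonzero τ_i, ℓ(μ−τ) is the number of indices with τ_i < μ_i, and (μ−τ)∪b is the partition of n−λ_1 obtained by rearranging in decreasing order the nonzero parts μ_i − τ_i together with the parts b_1,…,b_{ℓ(b)} of b. -/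

import Mathlib

/-!
STATEMENT 7 (Theorem 3.3, dual Murnaghan–Nakayama rule): for λ, μ ⊢ n, N ≥ n,
χ^λ_μ(q) = ∑_{τ ∈ C_μ} q^{λ_1 − ℓ(τ)} ∑_{b ∈ B_{|τ|−λ_1}}
  (q−1)^{ℓ(τ) − ℓ(μ) + ℓ(μ−τ) + ℓ(b)} (∏_{j=1}^{ℓ(b)} 1/(q^{−r_j(b)} − 1))
    χ^{λ^{[1]}}_{(μ−τ)∪b}(q),
where χ^λ_μ(q) = (q^n/(q−1)^{ℓ(μ)}) ⟨q_μ(x;q^{−1}), s_λ⟩.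
-/

noncomputable section
open MvPolynomial

/-- The field ℚ(q) of rational functions. -/
abbrev K : Type := RatFunc ℚ

/-- z_λ = ∏_i i^{m_i(λ)} · m_i(λ)! , as a rational number. -/
def zCoeff {n : ℕ} (lam : Nat.Partition n) : ℚ :=
  (lam.parts.map fun i => (i : ℚ)).prod *
    ∏ i ∈ lam.parts.toFinset, (Nat.factorial (lam.parts.count i) : ℚ)

/-- z_λ(t) = z_λ / ∏_j (1 − t^{λ_j}). -/
def zCoeffT {n : ℕ} (t : K) (lam : Nat.Partition n) : K :=
  ((zCoeff lam : ℚ) : K) / (lam.parts.map fun j => 1 - t ^ j).prod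

/-- The power-sum product p_λ = p_{λ_1} p_{λ_2} ⋯ in N variables. -/
def pPoly (N : ℕ) {n : ℕ} (lam : Nat.Partition n) : MvPolynomial (Fin N) K :=
  (lam.parts.map fun r => psum (Fin N) K r).prod

/-- The one-row Hall–Littlewood function q_r(x;t) = ∑_{λ⊢r} p_λ / z_λ(t). -/
def qone (N : ℕ) (t : K) (r : ℕ) : MvPolynomial (Fin N) K :=
  ∑ lam : Nat.Partition r, C (zCoeffT t lam)⁻¹ * pPoly N lam

/-- q of a multiset of positive integers: the product of one-row functions. -/
def qMulti (N : ℕ) (t : K) (s : Multiset ℕ) : MvPolynomial (Fin N) K :=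
  (s.map (qone N t)).prod

/-- The parts of a multiset, sorted in decreasing order. -/
def descSort (s : Multiset ℕ) : List ℕ := (s.sort (· ≤ ·)).reverse

/-- Vandermonde product ∏_{i<j} (x_i − x_j). -/
def vandermonde (N : ℕ) : MvPolynomial (Fin N) K :=
  ∏ p ∈ Finset.univ.filter (fun p : Fin N × Fin N => p.1 < p.2), (X p.1 - X p.2)

/-- Hall pairing ⟨f, s_λ⟩: the coefficient of x_1^{λ_1+N-1}⋯x_N^{λ_N} in
f · ∏_{i<j}(x_i − x_j), where λ is given as a function `Fin N → ℕ`. -/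
def hallPair (N : ℕ) (f : MvPolynomial (Fin N) K) (lamF : Fin N → ℕ) : K :=
  MvPolynomial.coeff
    (Finsupp.equivFunOnFinite.symm fun i : Fin N => lamF i + (N - 1 - (i : ℕ)))
    (f * vandermonde N)

/-- χ^λ_μ(q) = (q^{|μ|}/(q−1)^{ℓ(μ)}) ⟨q_μ(x;q^{−1}), s_λ⟩, where λ is given
by its padded exponent function and μ by its multiset of parts. -/
def chiGen (N : ℕ) (lamF : Fin N → ℕ) (muP : Multiset ℕ) : K :=
  ((RatFunc.X : K) ^ muP.sum / ((RatFunc.X : K) - 1) ^ (Multiset.card muP)) *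
    hallPair N (qMulti N (RatFunc.X : K)⁻¹ muP) lamF

/-- The weight `z` of a multiset of positive integers. -/
def zMulti (s : Multiset ℕ) : ℚ :=
  (s.map fun i : ℕ => (i : ℚ)).prod * ∏ i ∈ s.toFinset, (Nat.factorial (s.count i) : ℚ)

theorem zCoeff_eq_zMulti {n : ℕ} (lam : Nat.Partition n) : zCoeff lam = zMulti lam.parts := by
  simp [zCoeff, zMulti]

theorem zMulti_cons (i : ℕ) (s : Multiset ℕ) :
    zMulti (i ::ₘ s) = (i : ℚ) * ((i ::ₘ s).count i : ℚ) * zMulti s := by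
  have h1 : ∏ j ∈ s.toFinset, (Nat.factorial (s.count j) : ℚ)
      = ∏ j ∈ insert i s.toFinset, (Nat.factorial (s.count j) : ℚ) := by
    refine Finset.prod_subset (Finset.subset_insert _ _) fun j _ hj => ?_
    rw [Multiset.mem_toFinset] at hj
    simp [Multiset.count_eq_zero_of_notMem hj]
  have h2 : ∀ j ∈ insert i s.toFinset, (Nat.factorial ((i ::ₘ s).count j) : ℚ)
      = (if i = j then ((i ::ₘ s).count i : ℚ) else 1) * (Nat.factorial (s.count j) : ℚ) := by
    intro j _
    by_cases h : i = j
    · subst h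
      simp [Nat.factorial_succ]
    · simp [h, Multiset.count_cons_of_ne (Ne.symm h)]
  unfold zMulti
  rw [Multiset.toFinset_cons, Finset.prod_congr rfl h2, Finset.prod_mul_distrib,
    Finset.prod_ite_eq, if_pos (Finset.mem_insert_self _ _), ← h1, Multiset.map_cons,
    Multiset.prod_cons]
  ring

theorem zMulti_ne_zero {s : Multiset ℕ} (hs : ∀ i ∈ s, 0 < i) : zMulti s ≠ 0 := by
  refine mul_ne_zero (Multiset.prod_ne_zero fun h => ?_) ?_
  · obtain ⟨i, hi, h0⟩ := Multiset.mem_map.1 h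
    have := hs i hi
    have : i = 0 := by exact_mod_cast h0
    omega
  · exact Finset.prod_ne_zero_iff.2 fun i _ => by exact_mod_cast Nat.factorial_ne_zero _

section PowerSumExp

variable {R : Type*} [CommRing R] [Algebra K R]

/-- The degree `r` coefficient of `exp (∑ a_k z^k / k)`, written as a sum over partitions. -/
def powerSumExp (a : ℕ → R) (r : ℕ) : R :=
  ∑ lam : Nat.Partition r, algebraMap K R ((zCoeff lam : K)⁻¹) * (lam.parts.map a).prod

theorem powerSumExp_zero (a : ℕ → R) : powerSumExp a 0 = 1 := by
  unfold powerSumExp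
  rw [Fintype.sum_unique]
  simp [zCoeff_eq_zMulti, zMulti]

theorem map_powerSumExp {S : Type*} [CommRing S] [Algebra K S] (φ : R →ₐ[K] S) (a : ℕ → R)
    (r : ℕ) : φ (powerSumExp a r) = powerSumExp (fun k => φ (a k)) r := by
  simp [powerSumExp, map_sum, map_multiset_prod, Multiset.map_map]

theorem powerSumExp_congr {a b : ℕ → R} (h : ∀ k, 0 < k → a k = b k) (r : ℕ) :
    powerSumExp a r = powerSumExp b r := by
  unfold powerSumExp
  refine Finset.sum_congr rfl fun lam _ => ?_
  rw [Multiset.map_congr rfl fun k hk => h k (lam.parts_pos hk)]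

theorem succ_mul_powerSumExp (a : ℕ → R) (r : ℕ) :
    ((r : R) + 1) * powerSumExp a (r + 1)
      = ∑ p ∈ Finset.HasAntidiagonal.antidiagonal r, a (p.1 + 1) * powerSumExp a p.2 := by
  have hl : ((r : R) + 1) * powerSumExp a (r + 1)
      = ∑ x ∈ (Finset.univ : Finset (Nat.Partition (r + 1))).sigma fun lam => lam.parts.toFinset,
          ((x.1.parts.count x.2 * x.2 : ℕ) : R)
            * (algebraMap K R ((zCoeff x.1 : K)⁻¹) * (x.1.parts.map a).prod) := by
    rw [Finset.sum_sigma, powerSumExp, Finset.mul_sum]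
    refine Finset.sum_congr rfl fun lam _ => ?_
    dsimp only
    rw [← Finset.sum_mul]
    congr 1
    have := congrArg (Nat.cast : ℕ → R) (lam.parts_sum.symm.trans
      (Finset.sum_multiset_count lam.parts))
    push_cast at this
    rw [this]
    simp
  rw [hl]
  simp_rw [powerSumExp, Finset.mul_sum]
  rw [Finset.sum_sigma']
  symm
  refine Finset.sum_bij
    (fun (x : Σ p : ℕ × ℕ, Nat.Partition p.2) hx =>
      (⟨⟨(x.1.1 + 1) ::ₘ x.2.parts, ?_, ?_⟩, x.1.1 + 1⟩ : Σ _ : Nat.Partition (r + 1), ℕ))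
      ?_ ?_ ?_ ?_
  · intro i hi
    rcases Multiset.mem_cons.1 hi with h | h
    · omega
    · exact x.2.parts_pos h
  · have := Finset.HasAntidiagonal.mem_antidiagonal.1 (Finset.mem_sigma.1 hx).1
    rw [Multiset.sum_cons, x.2.parts_sum]
    omega
  · intro x hx
    simp
  · rintro ⟨⟨k, j⟩, nu⟩ h1 ⟨⟨k', j'⟩, nu'⟩ h2 h
    have h1 := Finset.HasAntidiagonal.mem_antidiagonal.1 (Finset.mem_sigma.1 h1).1
    have h2 := Finset.HasAntidiagonal.mem_antidiagonal.1 (Finset.mem_sigma.1 h2).1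
    simp only [Sigma.mk.injEq, heq_eq_eq, Nat.Partition.mk.injEq] at h h1 h2
    obtain ⟨h3, h4⟩ := h
    obtain rfl : k = k' := by omega
    obtain rfl : j = j' := by omega
    have : nu = nu' := Nat.Partition.ext (by simpa using h3)
    rw [this]
  · rintro ⟨lam, i⟩ h
    have hi : i ∈ lam.parts := by simpa using h
    have hpos := lam.parts_pos hi
    have hle : i ≤ r + 1 := by
      have := Multiset.le_sum_of_mem hi
      rwa [lam.parts_sum] at this
    have hc := Multiset.cons_erase hi
    refine ⟨⟨(i - 1, r + 1 - i), ⟨lam.parts.erase i, fun hj =>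
      lam.parts_pos (Multiset.mem_of_mem_erase hj), ?_⟩⟩, ?_, ?_⟩
    · have := congrArg Multiset.sum hc
      rw [Multiset.sum_cons, lam.parts_sum] at this
      simp only
      omega
    · simp
      omega
    · have : i - 1 + 1 = i := by omega
      simp only [Sigma.mk.injEq, heq_eq_eq, this, and_true]
      exact Nat.Partition.ext hc
  · rintro ⟨⟨k, j⟩, nu⟩ hx
    have hz := zMulti_ne_zero (s := nu.parts) fun i hi => nu.parts_pos hi
    simp only [zCoeff_eq_zMulti, zMulti_cons, Multiset.map_cons, Multiset.prod_cons]
    have hc : (((k + 1) ::ₘ nu.parts).count (k + 1) : ℚ) ≠ 0 := by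
      rw [Multiset.count_cons_self]
      positivity
    have hk : ((k : ℚ) + 1) ≠ 0 := by positivity
    generalize ((k + 1) ::ₘ nu.parts).count (k + 1) = c at hc ⊢
    have key : algebraMap K R ((zMulti nu.parts : K)⁻¹)
        = ((c * (k + 1) : ℕ) : R)
          * algebraMap K R (((((k + 1 : ℕ) : ℚ) * (c : ℚ) * zMulti nu.parts : ℚ) : K)⁻¹) := by
      rw [← map_natCast (algebraMap K R), ← map_mul]
      congr 1
      have : ((zMulti nu.parts)⁻¹ : ℚ) = ((c * (k + 1) : ℕ) : ℚ)
          * (((k + 1 : ℕ) : ℚ) * (c : ℚ) * zMulti nu.parts)⁻¹ := by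
        push_cast
        field_simp
      have := congrArg (Rat.cast : ℚ → K) this
      push_cast at this ⊢
      exact this
    rw [key]
    ring

theorem eq_powerSumExp (a f : ℕ → R) (h0 : f 0 = 1)
    (hs : ∀ r : ℕ, ((r : R) + 1) * f (r + 1)
      = ∑ p ∈ Finset.HasAntidiagonal.antidiagonal r, a (p.1 + 1) * f p.2) (r : ℕ) :
    f r = powerSumExp a r := by
  induction r using Nat.strong_induction_on with
  | _ r ih =>
    cases r with
    | zero => rw [h0, powerSumExp_zero]
    | succ r =>
      have h : ((r : R) + 1) * f (r + 1) = ((r : R) + 1) * powerSumExp a (r + 1) := by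
        rw [hs, succ_mul_powerSumExp]
        refine Finset.sum_congr rfl fun p hp => ?_
        have := Finset.HasAntidiagonal.mem_antidiagonal.1 hp
        rw [ih p.2 (by omega)]
      have hu : algebraMap K R (((r : K) + 1)⁻¹) * ((r : R) + 1) = 1 := by
        have hr : ((r : K) + 1) ≠ 0 := by exact_mod_cast Nat.succ_ne_zero r
        have : ((r : R) + 1) = algebraMap K R ((r : K) + 1) := by simp
        rw [this, ← map_mul, inv_mul_cancel₀ hr, map_one]
      have := congrArg (algebraMap K R (((r : K) + 1)⁻¹) * ·) h
      simpa [← mul_assoc, hu] using this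

theorem mk_powerSumExp_add (a b : ℕ → R) :
    PowerSeries.mk (powerSumExp fun k => a k + b k)
      = PowerSeries.mk (powerSumExp a) * PowerSeries.mk (powerSumExp b) := by
  have hd : ∀ c : ℕ → R, PowerSeries.derivative R (PowerSeries.mk (powerSumExp c))
      = PowerSeries.mk (fun k => c (k + 1)) * PowerSeries.mk (powerSumExp c) := by
    intro c
    ext r
    rw [PowerSeries.coeff_derivative, PowerSeries.coeff_mul, PowerSeries.coeff_mk, mul_comm,
      succ_mul_powerSumExp]
    simp
  ext r
  rw [PowerSeries.coeff_mk]
  symm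
  refine eq_powerSumExp _ (fun r => PowerSeries.coeff r
    (PowerSeries.mk (powerSumExp a) * PowerSeries.mk (powerSumExp b))) ?_ (fun r => ?_) r
  · simp [powerSumExp_zero]
  · have h : PowerSeries.derivative R
        (PowerSeries.mk (powerSumExp a) * PowerSeries.mk (powerSumExp b))
        = PowerSeries.mk (fun k => a (k + 1) + b (k + 1))
          * (PowerSeries.mk (powerSumExp a) * PowerSeries.mk (powerSumExp b)) := by
      have hab : PowerSeries.mk (fun k => a (k + 1) + b (k + 1))
          = PowerSeries.mk (fun k => a (k + 1)) + PowerSeries.mk (fun k => b (k + 1)) := by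
        ext; simp
      rw [Derivation.leibniz, hd, hd, hab, smul_eq_mul, smul_eq_mul]
      ring
    have := congrArg (PowerSeries.coeff r) h
    rw [PowerSeries.coeff_derivative, PowerSeries.coeff_mul r (PowerSeries.mk _)] at this
    rw [mul_comm, this]
    simp

theorem mk_powerSumExp_sum {ι : Type*} (s : Finset ι) (a : ι → ℕ → R) :
    PowerSeries.mk (powerSumExp fun k => ∑ i ∈ s, a i k)
      = ∏ i ∈ s, PowerSeries.mk (powerSumExp (a i)) := by
  classical
  induction s using Finset.induction_on with
  | empty =>
    ext r
    rw [PowerSeries.coeff_mk, Finset.prod_empty]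
    symm
    refine eq_powerSumExp _ (fun r => PowerSeries.coeff r (1 : PowerSeries R)) ?_ (fun r => ?_) r
    · simp
    · simp [PowerSeries.coeff_one]
  | insert i s hi ih =>
    rw [Finset.prod_insert hi, ← ih, ← mk_powerSumExp_add]
    simp_rw [Finset.sum_insert hi]

theorem powerSumExp_single (c x : R) (r : ℕ) :
    powerSumExp (fun k => (1 - c ^ k) * x ^ k) r = if r = 0 then 1 else (1 - c) * x ^ r := by
  symm
  refine eq_powerSumExp _ (fun r => if r = 0 then 1 else (1 - c) * x ^ r) (by simp)
    (fun r => ?_) r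
  rw [Finset.Nat.sum_antidiagonal_eq_sum_range_succ
    (fun i j => (1 - c ^ (i + 1)) * x ^ (i + 1) * (if j = 0 then 1 else (1 - c) * x ^ j)),
    Finset.sum_range_succ]
  have hg : (∑ k ∈ Finset.range r, (1 - c ^ (k + 1)) * (1 - c)) + (1 - c ^ (r + 1))
      = ((r : R) + 1) * (1 - c) := by
    induction r with
    | zero => simp
    | succ r ih =>
      rw [Finset.sum_range_succ]
      push_cast
      linear_combination ih
  have ht : ∀ k ∈ Finset.range r,
      (1 - c ^ (k + 1)) * x ^ (k + 1) * (if r - k = 0 then 1 else (1 - c) * x ^ (r - k))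
        = (1 - c ^ (k + 1)) * (1 - c) * x ^ (r + 1) := by
    intro k hk
    have hk := Finset.mem_range.1 hk
    rw [if_neg (by omega), show r + 1 = (k + 1) + (r - k) by omega, pow_add x]
    ring
  rw [Finset.sum_congr rfl ht, ← Finset.sum_mul]
  simp only [Nat.sub_self, if_true, Nat.succ_ne_zero, if_false]
  linear_combination -x ^ (r + 1) * hg

theorem one_sub_mul_mk_powerSumExp_single (c x : R) :
    (1 - PowerSeries.C x * PowerSeries.X)
        * PowerSeries.mk (powerSumExp fun k => (1 - c ^ k) * x ^ k)
      = 1 - PowerSeries.C (c * x) * PowerSeries.X := by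
  ext r
  rw [sub_mul, one_mul, mul_assoc, map_sub, map_sub, PowerSeries.coeff_C_mul,
    PowerSeries.coeff_C_mul, PowerSeries.coeff_mk, powerSumExp_single]
  rcases r with _ | _ | r
  · simp
  · simp [PowerSeries.coeff_one, PowerSeries.coeff_succ_X_mul, powerSumExp_single]
    ring
  · simp [PowerSeries.coeff_one, PowerSeries.coeff_succ_X_mul, powerSumExp_single,
      PowerSeries.coeff_X]
    ring

end PowerSumExp

section SignedEsymmSeries

variable {R : Type*} [CommRing R]

/-- The series `∏ (1 - x_j z)`, whose coefficients are signed elementary symmetric functions. -/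
def signedEsymmSeries {ι : Type*} (s : Finset ι) (x : ι → R) : PowerSeries R :=
  ∏ j ∈ s, (1 - PowerSeries.C (x j) * PowerSeries.X)

theorem coeff_signedEsymmSeries_of_card_lt {ι : Type*} (s : Finset ι) (x : ι → R) (m : ℕ)
    (hm : s.card < m) : PowerSeries.coeff m (signedEsymmSeries s x) = 0 := by
  classical
  unfold signedEsymmSeries
  induction s using Finset.induction_on generalizing m with
  | empty =>
    have : m ≠ 0 := by
      rintro rfl
      simp at hm
    simp [PowerSeries.coeff_one, this]
  | insert a s ha ih =>
    rw [Finset.card_insert_of_notMem ha] at hm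
    obtain ⟨m, rfl⟩ := Nat.exists_eq_succ_of_ne_zero (show m ≠ 0 by omega)
    rw [Finset.prod_insert ha, sub_mul, one_mul, mul_assoc, map_sub, PowerSeries.coeff_C_mul,
      PowerSeries.coeff_succ_X_mul, ih _ (by omega), ih _ (by omega)]
    simp

theorem coeff_prod_X_sub_C_of_card_lt {ι : Type*} (s : Finset ι) (x : ι → R) (i : ℕ)
    (hi : s.card < i) : (∏ j ∈ s, (Polynomial.X - Polynomial.C (x j))).coeff i = 0 := by
  classical
  induction s using Finset.induction_on generalizing i with
  | empty =>
    have : i ≠ 0 := by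
      rintro rfl
      simp at hi
    simp [Polynomial.coeff_one, this]
  | insert a s ha ih =>
    rw [Finset.card_insert_of_notMem ha] at hi
    obtain ⟨i, rfl⟩ := Nat.exists_eq_succ_of_ne_zero (show i ≠ 0 by omega)
    rw [Finset.prod_insert ha, sub_mul, Polynomial.coeff_sub, Polynomial.coeff_X_mul,
      Polynomial.coeff_C_mul, ih _ (by omega), ih _ (by omega)]
    simp

theorem coeff_prod_X_sub_C_eq {ι : Type*} (s : Finset ι) (x : ι → R) (i m : ℕ)
    (h : i + m = s.card) : (∏ j ∈ s, (Polynomial.X - Polynomial.C (x j))).coeff i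
      = PowerSeries.coeff m (signedEsymmSeries s x) := by
  classical
  induction s using Finset.induction_on generalizing i m with
  | empty =>
    obtain ⟨rfl, rfl⟩ : i = 0 ∧ m = 0 := by simpa using h
    simp [signedEsymmSeries]
  | insert a s ha ih =>
    rw [Finset.card_insert_of_notMem ha] at h
    have hE : signedEsymmSeries (insert a s) x
        = (1 - PowerSeries.C (x a) * PowerSeries.X) * signedEsymmSeries s x := by
      simp [signedEsymmSeries, Finset.prod_insert ha]
    rw [Finset.prod_insert ha, hE, sub_mul, sub_mul, one_mul, mul_assoc, map_sub,
      Polynomial.coeff_sub, Polynomial.coeff_C_mul, PowerSeries.coeff_C_mul]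
    rcases i with _ | i <;> rcases m with _ | m
    · omega
    · rw [coeff_signedEsymmSeries_of_card_lt _ _ _ (show s.card < m + 1 by omega),
        PowerSeries.coeff_succ_X_mul, ih 0 m (by omega)]
      simp
    · rw [coeff_prod_X_sub_C_of_card_lt _ _ _ (show s.card < i + 1 by omega),
        Polynomial.coeff_X_mul, ih i 0 (by omega)]
      simp
    · rw [Polynomial.coeff_X_mul, PowerSeries.coeff_succ_X_mul, ih i (m + 1) (by omega),
        ih (i + 1) m (by omega)]

theorem coeff_mul_X_pow_mul_prod_X_sub_C {ι : Type*} (s : Finset ι) (x : ι → R) (g V : R)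
    (k L : ℕ) :
    ((Polynomial.C g * Polynomial.X ^ k)
        * ((∏ j ∈ s, (Polynomial.X - Polynomial.C (x j))) * Polynomial.C V)).coeff (L + s.card)
      = if L ≤ k then PowerSeries.coeff (k - L) (signedEsymmSeries s x) * g * V else 0 := by
  have h : (Polynomial.C g * Polynomial.X ^ k)
        * ((∏ j ∈ s, (Polynomial.X - Polynomial.C (x j))) * Polynomial.C V)
      = Polynomial.C (g * V) * ((∏ j ∈ s, (Polynomial.X - Polynomial.C (x j)))
        * Polynomial.X ^ k) := by
    rw [Polynomial.C_mul]
    ring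
  rw [h, Polynomial.coeff_C_mul, Polynomial.coeff_mul_X_pow']
  by_cases hL : L ≤ k
  · rw [if_pos hL]
    by_cases hk : k ≤ L + s.card
    · rw [if_pos hk, coeff_prod_X_sub_C_eq s x _ (k - L) (by omega)]
      ring
    · rw [if_neg hk, coeff_signedEsymmSeries_of_card_lt _ _ _ (by omega)]
      ring
  · rw [if_neg hL, if_pos (by omega), coeff_prod_X_sub_C_of_card_lt _ _ _ (by omega), mul_zero]

theorem mk_powerSumExp_mul_signedEsymmSeries [Algebra K R] {ι : Type*} (s : Finset ι)
    (x : ι → R) (c : R) :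
    PowerSeries.mk (powerSumExp fun k => (1 - c ^ k) * ∑ i ∈ s, x i ^ k) * signedEsymmSeries s x
      = PowerSeries.rescale c (signedEsymmSeries s x) := by
  simp_rw [Finset.mul_sum]
  rw [mk_powerSumExp_sum, signedEsymmSeries, ← Finset.prod_mul_distrib, map_prod]
  refine Finset.prod_congr rfl fun i _ => ?_
  rw [mul_comm, one_sub_mul_mk_powerSumExp_single, map_sub, map_one]
  congr 1
  ext r
  rw [PowerSeries.coeff_rescale, PowerSeries.coeff_C_mul, PowerSeries.coeff_C_mul,
    PowerSeries.coeff_X]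
  by_cases hr : r = 1 <;> simp [hr]

end SignedEsymmSeries

theorem qone_eq_powerSumExp (N : ℕ) (t : K) (r : ℕ) :
    qone N t r = powerSumExp (fun k => (1 - C t ^ k) * psum (Fin N) K k) r := by
  unfold qone powerSumExp
  refine Finset.sum_congr rfl fun lam _ => ?_
  rw [zCoeffT, inv_div, div_eq_mul_inv, C_mul, pPoly, Multiset.prod_map_mul,
    algebraMap_eq, map_multiset_prod, Multiset.map_map]
  simp only [Function.comp_def, map_sub, map_one, map_pow]
  ring

theorem qone_zero (N : ℕ) (t : K) : qone N t 0 = 1 := by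
  rw [qone_eq_powerSumExp, powerSumExp_zero]

/-- The coefficient of `z ^ m` in `∏ (1 - x_j z)`. -/
def signedEsymm (N m : ℕ) : MvPolynomial (Fin N) K :=
  PowerSeries.coeff m (signedEsymmSeries Finset.univ (X : Fin N → MvPolynomial (Fin N) K))

theorem mk_qone_mul_signedEsymmSeries (N : ℕ) (t : K) :
    PowerSeries.mk (qone N t)
        * signedEsymmSeries Finset.univ (X : Fin N → MvPolynomial (Fin N) K)
      = PowerSeries.rescale (C t) (signedEsymmSeries Finset.univ X) := by
  rw [← mk_powerSumExp_mul_signedEsymmSeries]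
  congr 2
  funext r
  exact qone_eq_powerSumExp N t r

theorem sub_one_mul_signedEsymm (N : ℕ) (t : K) (m : ℕ) :
    C (t ^ m - 1) * signedEsymm N m
      = ∑ k ∈ Finset.range m, qone N t (m - k) * signedEsymm N k := by
  have h := congrArg (PowerSeries.coeff m) (mk_qone_mul_signedEsymmSeries N t)
  rw [PowerSeries.coeff_rescale, mul_comm, PowerSeries.coeff_mul,
    Finset.Nat.sum_antidiagonal_eq_sum_range_succ
      (fun i j => PowerSeries.coeff i (signedEsymmSeries Finset.univ
        (X : Fin N → MvPolynomial (Fin N) K)) * PowerSeries.coeff j (PowerSeries.mk (qone N t))),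
    Finset.sum_range_succ] at h
  simp only [PowerSeries.coeff_mk, Nat.sub_self, qone_zero, mul_one] at h
  rw [map_sub, map_pow, map_one, sub_mul, one_mul]
  simp_rw [mul_comm (qone N t _)]
  exact (eq_sub_of_add_eq h).symm

theorem signedEsymm_zero (N : ℕ) : signedEsymm N 0 = 1 := by
  simp [signedEsymm, signedEsymmSeries, map_prod]

theorem sum_composition_succ {M : Type*} [AddCommMonoid M] (m : ℕ) (F : List ℕ → M) :
    ∑ b : Composition (m + 1), F b.blocks
      = ∑ k ∈ Finset.range (m + 1), ∑ c : Composition k, F (c.blocks ++ [m + 1 - k]) := by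
  rw [Finset.sum_sigma']
  symm
  refine Finset.sum_bij (fun (x : Σ k : ℕ, Composition k) hx =>
    (⟨x.2.blocks ++ [m + 1 - x.1], ?_, ?_⟩ : Composition (m + 1))) ?_ ?_ ?_ ?_
  · intro i hi
    have := Finset.mem_range.1 (Finset.mem_sigma.1 hx).1
    rcases List.mem_append.1 hi with h | h
    · exact x.2.blocks_pos h
    · rw [List.mem_singleton.1 h]
      omega
  · have := Finset.mem_range.1 (Finset.mem_sigma.1 hx).1
    rw [List.sum_append, x.2.blocks_sum, List.sum_singleton]
    omega
  · intro x hx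
    exact Finset.mem_univ _
  · rintro ⟨k, c⟩ h1 ⟨k', c'⟩ h2 h
    have h3 := congrArg Composition.blocks h
    simp only at h3
    have h4 := (List.append_inj' h3 rfl).1
    obtain rfl : k = k' := by rw [← c.blocks_sum, ← c'.blocks_sum, h4]
    rw [Composition.ext h4]
  · intro b _
    have hne : b.blocks ≠ [] := by
      intro h
      have := b.blocks_sum
      rw [h] at this
      simp at this
    have hd := List.dropLast_append_getLast hne
    have hs := congrArg List.sum hd
    rw [List.sum_append, List.sum_singleton, b.blocks_sum] at hs
    have hp := b.blocks_pos (List.getLast_mem hne)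
    refine ⟨⟨b.blocks.dropLast.sum, ⟨b.blocks.dropLast, fun h =>
      b.blocks_pos (List.mem_of_mem_dropLast h), rfl⟩⟩, ?_, ?_⟩
    · simp
      omega
    · refine Composition.ext ?_
      simp only
      rw [show m + 1 - b.blocks.dropLast.sum = b.blocks.getLast hne by omega, hd]
  · intro x hx
    rfl

/-- The product of `1 / (t ^ r - 1)` over the partial sums `r` of a list. -/
def brickWeight (t : K) (l : List ℕ) : K :=
  ∏ j ∈ Finset.range l.length, (t ^ (l.take (j + 1)).sum - 1)⁻¹

theorem brickWeight_append_singleton (t : K) (l : List ℕ) (k : ℕ) :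
    brickWeight t (l ++ [k]) = brickWeight t l * (t ^ (l.sum + k) - 1)⁻¹ := by
  unfold brickWeight
  rw [List.length_append, List.length_singleton, Finset.prod_range_succ]
  congr 1
  · refine Finset.prod_congr rfl fun j hj => ?_
    have := Finset.mem_range.1 hj
    rw [List.take_append_of_le_length (by omega)]
  · rw [List.take_of_length_le (by simp), List.sum_append, List.sum_singleton]

theorem signedEsymm_eq_sum_composition (N : ℕ) (t : K) (ht : ∀ m, 0 < m → t ^ m ≠ 1) (m : ℕ) :
    signedEsymm N m
      = ∑ b : Composition m, C (brickWeight t b.blocks) * qMulti N t (b.blocks : Multiset ℕ) := by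
  induction m using Nat.strong_induction_on with
  | _ m ih =>
    cases m with
    | zero =>
      have h : ∀ b : Composition 0, b.blocks = [] := by
        intro b
        refine List.eq_nil_iff_forall_not_mem.2 fun i hi => ?_
        have h1 := b.blocks_pos hi
        have h2 := List.single_le_sum (fun _ _ => Nat.zero_le _) i hi
        rw [b.blocks_sum] at h2
        omega
      simp_rw [h, Finset.sum_const, Finset.card_univ, composition_card]
      simp [signedEsymm_zero, brickWeight, qMulti]
    | succ m =>
      have h0 : t ^ (m + 1) - 1 ≠ 0 := sub_ne_zero.2 (ht _ m.succ_pos)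
      have h1 : signedEsymm N (m + 1)
          = C ((t ^ (m + 1) - 1)⁻¹) * (C (t ^ (m + 1) - 1) * signedEsymm N (m + 1)) := by
        rw [← mul_assoc, ← C_mul, inv_mul_cancel₀ h0, C_1, one_mul]
      rw [h1, sub_one_mul_signedEsymm,
        sum_composition_succ m fun l => C (brickWeight t l) * qMulti N t (l : Multiset ℕ),
        Finset.mul_sum]
      refine Finset.sum_congr rfl fun k hk => ?_
      have hk := Finset.mem_range.1 hk
      rw [ih k hk, Finset.mul_sum, Finset.mul_sum]
      refine Finset.sum_congr rfl fun c _ => ?_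
      rw [brickWeight_append_singleton, c.blocks_sum, show k + (m + 1 - k) = m + 1 by omega,
        C_mul]
      have : qMulti N t ((c.blocks ++ [m + 1 - k] : List ℕ) : Multiset ℕ)
          = qMulti N t (c.blocks : Multiset ℕ) * qone N t (m + 1 - k) := by
        simp [qMulti]
      rw [this]
      ring

theorem vandermonde_eq_prod_prod (N : ℕ) :
    vandermonde N = ∏ i : Fin N, ∏ j : Fin N, if i < j then X i - X j else 1 := by
  rw [vandermonde, Finset.prod_filter, Fintype.prod_prod_type]

theorem finSuccEquiv_vandermonde (N : ℕ) :
    finSuccEquiv K N (vandermonde (N + 1))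
      = (∏ j : Fin N, (Polynomial.X - Polynomial.C (X j))) * Polynomial.C (vandermonde N) := by
  rw [vandermonde_eq_prod_prod, vandermonde_eq_prod_prod, Fin.prod_univ_succ]
  simp only [Fin.prod_univ_succ, map_mul, map_prod]
  congr 1
  · simp [finSuccEquiv_X_zero, finSuccEquiv_X_succ]
  · refine Finset.prod_congr rfl fun i _ => ?_
    simp only [Fin.not_lt_zero, if_false, map_one, one_mul, Fin.succ_lt_succ_iff]
    refine Finset.prod_congr rfl fun j _ => ?_
    split_ifs <;> simp [finSuccEquiv_X_succ]

theorem finSuccEquiv_qone (N : ℕ) (t : K) (r : ℕ) :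
    finSuccEquiv K N (qone (N + 1) t r)
      = ∑ j : Fin (r + 1), Polynomial.C (C (if (j : ℕ) = 0 then 1 else 1 - t)
          * qone N t (r - j)) * Polynomial.X ^ (j : ℕ) := by
  have ha : ∀ k, finSuccEquiv K N ((1 - C t ^ k) * psum (Fin (N + 1)) K k)
      = (1 - Polynomial.C (C t) ^ k) * Polynomial.X ^ k
        + Polynomial.CAlgHom (R := K) ((1 - C t ^ k) * psum (Fin N) K k) := by
    intro k
    have hC : finSuccEquiv K N (C t) = Polynomial.C (C t) :=
      (finSuccEquiv K N).commutes t
    have hp : finSuccEquiv K N (psum (Fin (N + 1)) K k)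
        = Polynomial.X ^ k + Polynomial.C (psum (Fin N) K k) := by
      rw [psum, psum, Fin.sum_univ_succ]
      simp [finSuccEquiv_X_zero, finSuccEquiv_X_succ]
    rw [map_mul, map_sub, map_one, map_pow, hC, hp]
    simp [Polynomial.CAlgHom]
    ring
  have h := map_powerSumExp (finSuccEquiv K N).toAlgHom
    (fun k => (1 - C t ^ k) * psum (Fin (N + 1)) K k) r
  rw [← qone_eq_powerSumExp] at h
  refine Eq.trans h ?_
  have h2 := congrArg (PowerSeries.coeff r) (mk_powerSumExp_add
    (fun k => (1 - (Polynomial.C (C t) : Polynomial (MvPolynomial (Fin N) K)) ^ k)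
      * Polynomial.X ^ k)
    (fun k => Polynomial.CAlgHom (R := K) ((1 - C t ^ k) * psum (Fin N) K k)))
  rw [PowerSeries.coeff_mk] at h2
  refine (powerSumExp_congr (fun k _ => ha k) r).trans (h2.trans ?_)
  rw [PowerSeries.coeff_mul,
    Finset.Nat.sum_antidiagonal_eq_sum_range_succ_mk, Finset.sum_range]
  refine Finset.sum_congr rfl fun j _ => ?_
  rw [PowerSeries.coeff_mk, PowerSeries.coeff_mk, powerSumExp_single, ← map_powerSumExp,
    ← qone_eq_powerSumExp]
  by_cases hj : (j : ℕ) = 0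
  · simp [hj, Polynomial.CAlgHom]
  · simp [hj, Polynomial.CAlgHom]

theorem finSuccEquiv_prod_qone (N : ℕ) (t : K) {l : ℕ} (m : Fin l → ℕ) :
    finSuccEquiv K N (∏ i, qone (N + 1) t (m i))
      = ∑ τ : (∀ i, Fin (m i + 1)),
          Polynomial.C (C ((1 - t) ^ (Finset.univ.filter fun i => ((τ i : ℕ)) ≠ 0).card)
            * qMulti N t ((Finset.univ.filter fun i => ((τ i : ℕ)) < m i).val.map
                fun i => m i - (τ i : ℕ)))
          * Polynomial.X ^ (∑ i, (τ i : ℕ)) := by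
  rw [map_prod]
  simp_rw [finSuccEquiv_qone]
  rw [Finset.prod_univ_sum, Fintype.piFinset_univ]
  refine Finset.sum_congr rfl fun τ _ => ?_
  rw [Finset.prod_mul_distrib, Finset.prod_pow_eq_pow_sum, ← map_prod, Finset.prod_mul_distrib,
    ← map_prod]
  congr 4
  · rw [Finset.prod_ite, Finset.prod_const_one, one_mul, Finset.prod_const]
  · rw [qMulti, Multiset.map_map]
    refine (Finset.prod_subset (Finset.filter_subset _ _) fun i _ hi => ?_).symm
    have : m i - (τ i : ℕ) = 0 := by
      simp at hi
      omega
    rw [this, qone_zero]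

theorem hallPair_sum {ι : Type*} (N : ℕ) (s : Finset ι) (f : ι → MvPolynomial (Fin N) K)
    (lamF : Fin N → ℕ) : hallPair N (∑ i ∈ s, f i) lamF = ∑ i ∈ s, hallPair N (f i) lamF := by
  simp [hallPair, Finset.sum_mul, coeff_sum]

theorem hallPair_C_mul (N : ℕ) (c : K) (f : MvPolynomial (Fin N) K) (lamF : Fin N → ℕ) :
    hallPair N (C c * f) lamF = c * hallPair N f lamF := by
  rw [hallPair, mul_assoc, coeff_C_mul, hallPair]

theorem hallPair_succ (N : ℕ) (f : MvPolynomial (Fin (N + 1)) K) (lamF : Fin (N + 1) → ℕ)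
    {ι : Type*} (s : Finset ι) (g : ι → MvPolynomial (Fin N) K) (d : ι → ℕ)
    (hf : finSuccEquiv K N f = ∑ τ ∈ s, Polynomial.C (g τ) * Polynomial.X ^ d τ) :
    hallPair (N + 1) f lamF = ∑ τ ∈ s, if lamF 0 ≤ d τ then
      hallPair N (signedEsymm N (d τ - lamF 0) * g τ) (fun i => lamF i.succ) else 0 := by
  have he : (Finsupp.equivFunOnFinite.symm
        fun i : Fin (N + 1) => lamF i + (N + 1 - 1 - (i : ℕ)))
      = Finsupp.cons (lamF 0 + N) (Finsupp.equivFunOnFinite.symm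
        fun i : Fin N => lamF i.succ + (N - 1 - (i : ℕ))) := by
    ext i
    refine Fin.cases ?_ (fun i => ?_) i
    · simp
    · simp
      omega
  rw [hallPair, he, ← finSuccEquiv_coeff_coeff, map_mul, hf, finSuccEquiv_vandermonde,
    Finset.sum_mul, Polynomial.finsetSum_coeff, coeff_sum]
  refine Finset.sum_congr rfl fun τ _ => ?_
  have := coeff_mul_X_pow_mul_prod_X_sub_C (Finset.univ : Finset (Fin N))
    (X : Fin N → MvPolynomial (Fin N) K) (g τ) (vandermonde N) (d τ) (lamF 0)
  rw [Finset.card_univ, Fintype.card_fin] at this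
  rw [this]
  split_ifs
  · rfl
  · simp

/-- Setting the last variable to zero. -/
def setLastZero (N : ℕ) : MvPolynomial (Fin (N + 1)) K →ₐ[K] MvPolynomial (Fin N) K :=
  killCompl (Fin.castSucc_injective N)

theorem setLastZero_X_castSucc (N : ℕ) (i : Fin N) : setLastZero N (X i.castSucc) = X i := by
  rw [setLastZero, ← rename_X Fin.castSucc i, killCompl_rename_app]

theorem setLastZero_X_last (N : ℕ) : setLastZero N (X (Fin.last N)) = 0 := by
  rw [setLastZero, killCompl, aeval_X, dif_neg]
  rintro ⟨i, hi⟩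
  exact (Fin.castSucc_lt_last i).ne hi

theorem setLastZero_qone (N : ℕ) (t : K) (r : ℕ) :
    setLastZero N (qone (N + 1) t r) = qone N t r := by
  rw [qone_eq_powerSumExp, qone_eq_powerSumExp, map_powerSumExp]
  refine powerSumExp_congr (fun k hk => ?_) r
  have hC : setLastZero N (C t) = C t := (setLastZero N).commutes t
  rw [map_mul, map_sub, map_one, map_pow, hC, psum, psum, Fin.sum_univ_castSucc]
  simp [setLastZero_X_castSucc, setLastZero_X_last, hk.ne']

theorem setLastZero_vandermonde (N : ℕ) :
    setLastZero N (vandermonde (N + 1)) = vandermonde N * ∏ i : Fin N, X i := by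
  rw [vandermonde_eq_prod_prod, vandermonde_eq_prod_prod, Fin.prod_univ_castSucc]
  simp only [Fin.prod_univ_castSucc, map_mul, map_prod]
  rw [Finset.prod_mul_distrib]
  have h : ∀ i : Fin N, ¬ Fin.last N < i.castSucc := fun i => not_lt.2 (Fin.castSucc_lt_last i).le
  simp only [h, if_false, lt_irrefl, map_one, Finset.prod_const_one, mul_one,
    Fin.castSucc_lt_last, if_true, map_sub, setLastZero_X_castSucc, setLastZero_X_last, sub_zero,
    Fin.castSucc_lt_castSucc_iff]
  congr 1
  refine Finset.prod_congr rfl fun i _ => Finset.prod_congr rfl fun j _ => ?_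
  split_ifs <;> simp [setLastZero_X_castSucc]

theorem hallPair_succ_of_last_eq_zero (N : ℕ) (f : MvPolynomial (Fin (N + 1)) K)
    (lamF : Fin (N + 1) → ℕ) (h : lamF (Fin.last N) = 0) :
    hallPair (N + 1) f lamF = hallPair N (setLastZero N f) (fun i => lamF i.castSucc) := by
  have he : (Finsupp.equivFunOnFinite.symm
        fun i : Fin (N + 1) => lamF i + (N + 1 - 1 - (i : ℕ)))
      = Finsupp.mapDomain Fin.castSucc ((Finsupp.equivFunOnFinite.symm
        fun i : Fin N => lamF i.castSucc + (N - 1 - (i : ℕ)))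
          + Finsupp.equivFunOnFinite.symm fun _ => 1) := by
    ext i
    refine Fin.lastCases ?_ (fun i => ?_) i
    · rw [Finsupp.mapDomain_of_notMem_range]
      · simp [h]
      · rintro ⟨i, hi⟩
        exact (Fin.castSucc_lt_last i).ne hi
    · rw [Finsupp.mapDomain_apply (Fin.castSucc_injective N)]
      simp
      omega
  have hX : (∏ i : Fin N, X i : MvPolynomial (Fin N) K)
      = monomial (Finsupp.equivFunOnFinite.symm fun _ => 1) 1 := by
    rw [monomial_eq, Finsupp.prod_fintype _ _ (by simp)]
    simp
  rw [hallPair, he, ← coeff_killCompl (Fin.castSucc_injective N), map_mul]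
  change coeff _ (setLastZero N f * setLastZero N (vandermonde (N + 1))) = _
  rw [setLastZero_vandermonde, ← mul_assoc, hX, coeff_mul_monomial, mul_one, hallPair]

theorem hallPair_qMulti_of_last_eq_zero (N : ℕ) (t : K) (s : Multiset ℕ)
    (lamF : Fin (N + 1) → ℕ) (h : lamF (Fin.last N) = 0) :
    hallPair (N + 1) (qMulti (N + 1) t s) lamF
      = hallPair N (qMulti N t s) (fun i => lamF i.castSucc) := by
  rw [hallPair_succ_of_last_eq_zero N _ _ h, qMulti, map_multiset_prod, Multiset.map_map]
  simp [setLastZero_qone, qMulti]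

theorem qMulti_add (N : ℕ) (t : K) (s u : Multiset ℕ) :
    qMulti N t (s + u) = qMulti N t s * qMulti N t u := by
  simp [qMulti]

theorem ratFunc_X_inv_pow_ne_one (m : ℕ) (hm : 0 < m) : (RatFunc.X : K)⁻¹ ^ m ≠ 1 := by
  intro h
  rw [inv_pow, inv_eq_one, ← RatFunc.algebraMap_X, ← map_pow,
    ← map_one (algebraMap (Polynomial ℚ) (RatFunc ℚ))] at h
  have h1 := RatFunc.algebraMap_injective ℚ h
  have h2 := congrArg Polynomial.natDegree h1
  simp at h2
  omega

theorem hallPair_qMulti_eq_sum (N : ℕ) (t : K) (ht : ∀ m, 0 < m → t ^ m ≠ 1) {l : ℕ}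
    (m : Fin l → ℕ) (lamF : ℕ → ℕ) (h : lamF (N + 1) = 0) :
    hallPair (N + 1) (∏ i, qone (N + 1) t (m i)) (fun i => lamF i)
      = ∑ τ : (∀ i, Fin (m i + 1)), if lamF 0 ≤ ∑ i, (τ i : ℕ) then
          ∑ b : Composition ((∑ i, (τ i : ℕ)) - lamF 0),
            (1 - t) ^ (Finset.univ.filter fun i => ((τ i : ℕ)) ≠ 0).card
              * brickWeight t b.blocks
              * hallPair (N + 1) (qMulti (N + 1) t
                  (((Finset.univ.filter fun i => ((τ i : ℕ)) < m i).val.map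
                    fun i => m i - (τ i : ℕ)) + (b.blocks : Multiset ℕ)))
                (fun i => lamF ((i : ℕ) + 1))
        else 0 := by
  rw [hallPair_succ N _ _ _ _ _ (finSuccEquiv_prod_qone N t m)]
  refine Finset.sum_congr rfl fun τ _ => ?_
  by_cases hL : lamF 0 ≤ ∑ i, (τ i : ℕ)
  · refine (if_pos hL).trans ?_
    change hallPair N (signedEsymm N (_ - lamF 0) * _) (fun i => lamF ((i : ℕ) + 1)) = _
    rw [if_pos hL, signedEsymm_eq_sum_composition N t ht, Finset.sum_mul, hallPair_sum]
    refine Finset.sum_congr rfl fun b _ => ?_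
    rw [hallPair_qMulti_of_last_eq_zero _ _ _ _ (by simpa using h), qMulti_add, mul_assoc,
      ← hallPair_C_mul]
    refine congrArg₂ (hallPair N) ?_ rfl
    rw [C_mul]
    ring
  · exact (if_neg hL).trans (if_neg hL).symm

theorem coe_descSort (s : Multiset ℕ) : (descSort s : Multiset ℕ) = s := by
  rw [descSort, Multiset.coe_reverse, Multiset.sort_eq]

theorem chiGen_eq_succ (N : ℕ) (s : Multiset ℕ) (lamF : ℕ → ℕ) (h : lamF N = 0) :
    chiGen N (fun i => lamF i) s = chiGen (N + 1) (fun i => lamF i) s := by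
  rw [chiGen, chiGen, hallPair_qMulti_of_last_eq_zero N _ s (fun i => lamF i) (by simpa using h)]
  rfl

theorem sum_filter_lt_tsub {l : ℕ} {m : Fin l → ℕ} (τ : ∀ i, Fin (m i + 1)) :
    (∑ i ∈ Finset.univ.filter fun i => (τ i : ℕ) < m i, (m i - (τ i : ℕ))) + ∑ i, (τ i : ℕ)
      = ∑ i, m i := by
  rw [Finset.sum_filter, ← Finset.sum_add_distrib]
  refine Finset.sum_congr rfl fun i _ => ?_
  split_ifs <;> omega

theorem hecke_scalar_identity {F : Type*} [Field F] {a : F} (ha : a ≠ 0) (hd : a - 1 ≠ 0)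
    (n M T L D B S c : ℕ) (w H : F) (hn : L + S = n) (hc : c = D + B) :
    a ^ n / (a - 1) ^ M * ((1 - a⁻¹) ^ T * w * H)
      = a ^ ((L : ℤ) - T) * ((a - 1) ^ ((T : ℤ) - M + D + B) * w * (a ^ S / (a - 1) ^ c * H)) := by
  have h : 1 - a⁻¹ = (a - 1) / a := by field_simp
  subst hn hc
  rw [h, zpow_sub₀ ha, zpow_add₀ hd, zpow_add₀ hd, zpow_sub₀ hd]
  simp only [zpow_natCast, div_pow, pow_add]
  field_simp

theorem dual_murnaghan_nakayama_hecke (n N : ℕ) (hN : n ≤ N)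
    (lam mu : Nat.Partition n) :
    chiGen N (fun i : Fin N => (descSort lam.parts).getD (i : ℕ) 0) mu.parts
      = ∑ τ : (∀ i : Fin (descSort mu.parts).length, Fin ((descSort mu.parts).get i + 1)),
          if (descSort lam.parts).getD 0 0 ≤ ∑ i, ((τ i : ℕ)) then
            (RatFunc.X : K) ^ (((descSort lam.parts).getD 0 0 : ℤ)
                - (Finset.univ.filter fun i => ((τ i : ℕ)) ≠ 0).card)
              * ∑ b : Composition ((∑ i, ((τ i : ℕ))) - (descSort lam.parts).getD 0 0),
                  ((RatFunc.X : K) - 1) ^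
                      (((Finset.univ.filter fun i => ((τ i : ℕ)) ≠ 0).card : ℤ)
                        - (Multiset.card mu.parts : ℤ)
                        + (Finset.univ.filter fun i =>
                            ((τ i : ℕ)) < (descSort mu.parts).get i).card
                        + b.length)
                    * (∏ j ∈ Finset.range b.length,
                        ((RatFunc.X : K)⁻¹ ^ b.sizeUpTo (j + 1) - 1)⁻¹)
                    * chiGen N (fun i : Fin N => (descSort lam.parts).getD ((i : ℕ) + 1) 0)
                        (((Finset.univ.filter fun i =>
                              ((τ i : ℕ)) < (descSort mu.parts).get i).val.map
                            fun i => (descSort mu.parts).get i - (τ i : ℕ))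
                          + (↑b.blocks : Multiset ℕ))
          else 0 := by
  set lamF : ℕ → ℕ := fun k => (descSort lam.parts).getD k 0
  have hlam : ∀ k, n ≤ k → lamF k = 0 := by
    intro k hk
    have hlen : (descSort lam.parts).length ≤ n := by
      have h := Multiset.card_nsmul_le_sum (s := lam.parts) (a := 1) fun i hi => lam.parts_pos hi
      rw [lam.parts_sum, smul_eq_mul, mul_one] at h
      rwa [← Multiset.coe_card, coe_descSort]
    exact List.getD_eq_default _ _ (hlen.trans hk)
  have hstab : ∀ s, chiGen N (fun i : Fin N => lamF i) s
      = chiGen (N + 1) (fun i : Fin (N + 1) => lamF i) s :=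
    fun s => chiGen_eq_succ N s lamF (hlam N hN)
  have hstab' : ∀ s, chiGen N (fun i : Fin N => lamF ((i : ℕ) + 1)) s
      = chiGen (N + 1) (fun i : Fin (N + 1) => lamF ((i : ℕ) + 1)) s :=
    fun s => chiGen_eq_succ N s (fun k => lamF (k + 1)) (hlam (N + 1) (by omega))
  have hmu : (∑ i, (descSort mu.parts).get i) = n := by
    rw [← List.sum_ofFn, List.ofFn_get, ← Multiset.sum_coe, coe_descSort, mu.parts_sum]
  have hq : ∀ M, qMulti M (RatFunc.X : K)⁻¹ mu.parts
      = ∏ i, qone M (RatFunc.X : K)⁻¹ ((descSort mu.parts).get i) := by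
    intro M
    rw [← List.prod_ofFn, ← Function.comp_def, ← List.map_ofFn, List.ofFn_get, ← Multiset.prod_coe,
      ← Multiset.map_coe, coe_descSort, qMulti]
  change chiGen N (fun i : Fin N => lamF i) mu.parts = _
  rw [hstab, chiGen, hq, hallPair_qMulti_eq_sum N _ ratFunc_X_inv_pow_ne_one _ _
    (hlam (N + 1) (by omega)), Finset.mul_sum, mu.parts_sum]
  refine Finset.sum_congr rfl fun τ _ => ?_
  by_cases hL : lamF 0 ≤ ∑ i, (τ i : ℕ)
  · refine Eq.trans ?_ (if_pos hL).symm
    rw [if_pos hL, Finset.mul_sum, Finset.mul_sum]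
    refine Finset.sum_congr rfl fun b _ => ?_
    change _ = _ * (_ * brickWeight _ b.blocks
      * chiGen N (fun i : Fin N => lamF ((i : ℕ) + 1)) _)
    rw [hstab', chiGen]
    refine hecke_scalar_identity RatFunc.X_ne_zero (sub_ne_zero.2 ?_) _ _ _ _ _ _ _ _ _ _
      ?_ ?_
    · intro h
      exact ratFunc_X_inv_pow_ne_one 1 one_pos (by simp [h])
    · have hb := b.blocks_sum
      have hs := sum_filter_lt_tsub τ
      rw [hmu] at hs
      rw [Multiset.sum_add, Multiset.sum_coe, hb]
      change lamF 0 + (Finset.sum _ _ + _) = n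
      omega
    · rw [Multiset.card_add, Multiset.card_map, Multiset.coe_card]
      rfl
  · rw [if_neg hL, mul_zero]
    exact (if_neg hL).symm

end
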